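/- For all distributions μ1, μ2 ∈ D(Proc), every p ∈ [0,1], and every predicate φ ⊆ Proc, the testing outcomes satisfy O^{p·μ1+(1−p)·μ2}_φ = p·O^{μ1}_φ + (1−p)·O^{μ2}_φ, where the right-hand side is the Minkowski sum { p·x + (1−p)·y : x ∈ O^{μ1}_φ, y ∈ O^{μ2}_φ }. -/

import Mathlib

open scoped Classical

/-- Finitely supported probability distributions on `α`. -/
structure FinDist (α : Type) where
  toFun : α → ℝ
  nonneg : ∀ a, 0 ≤ toFun a
  finite_support : (Function.support toFun).Finite
  sum_one : ∑ᶠ a, toFun a = 1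

namespace FinDist

/-- The probability that a predicate (set) `φ` is satisfied under `μ`. -/
noncomputable def mass {α : Type} (μ : FinDist α) (φ : Set α) : ℝ :=
  ∑ᶠ a ∈ φ, μ.toFun a

end FinDist

section Transitions

variable {Proc Act : Type}

/-- A single probabilistic transition between distributions: `μ →(α,p) ν` iff
`0 < p ≤ 1` and there are `P ∈ supp μ` and `ρ` with `P →α ρ` (single-step relation
`step`) and `ν = μ + μ(P)·p·(ρ − δ_P)`. -/
def DStep (step : Proc → Act → FinDist Proc → Prop)
    (μ : FinDist Proc) (α : Act) (p : ℝ) (ν : FinDist Proc) : Prop :=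
  0 < p ∧ p ≤ 1 ∧
    ∃ P ρ, 0 < μ.toFun P ∧ step P α ρ ∧
      ∀ Q, ν.toFun Q = μ.toFun Q + μ.toFun P * p * (ρ.toFun Q - (if Q = P then 1 else 0))

/-- Probabilistic transition sequence `μ →π ν` along a word `π`. -/
def DSeq (step : Proc → Act → FinDist Proc → Prop) :
    FinDist Proc → List (Act × ℝ) → FinDist Proc → Prop
  | μ, [], ν => ν = μ
  | μ, s :: π, ν => ∃ μ', DStep step μ s.1 s.2 μ' ∧ DSeq step μ' π ν

end Transitions
section Testing

variable {Proc Act : Type}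

/-- Internal transition sequence `μ ⇝ ν`: a finite composition of `→(τ,p)` steps. -/
def Internal (step : Proc → Act → FinDist Proc → Prop) (tau : Act)
    (μ ν : FinDist Proc) : Prop :=
  ∃ π : List (Act × ℝ), (∀ s ∈ π, s.1 = tau) ∧ DSeq step μ π ν

/-- Internal transition sequence with a degenerate witness (`every step has p = 1`),
written `μ →τ* ν`. -/
def Degenerate (step : Proc → Act → FinDist Proc → Prop) (tau : Act)
    (μ ν : FinDist Proc) : Prop :=
  ∃ π : List (Act × ℝ), (∀ s ∈ π, s.1 = tau ∧ s.2 = 1) ∧ DSeq step μ π ν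

/-- Testing outcomes `O^μ_φ = { ν(φ) : μ ⇝ ν }`. -/
def Outcomes (step : Proc → Act → FinDist Proc → Prop) (tau : Act)
    (φ : Set Proc) (μ : FinDist Proc) : Set ℝ :=
  {x | ∃ ν, Internal step tau μ ν ∧ x = ν.mass φ}

end Testing

theorem FinDist.ext_fun {α : Type} {μ ν : FinDist α} (h : ∀ a, μ.toFun a = ν.toFun a) : μ = ν := by
  cases μ; cases ν
  have := funext h
  simp only at this
  subst this
  rfl

theorem FinDist.exists_mix {α : Type} (μ1 μ2 : FinDist α) (p : ℝ) (hp0 : 0 ≤ p) (hp1 : p ≤ 1) :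
    ∃ μ : FinDist α, ∀ Q, μ.toFun Q = p * μ1.toFun Q + (1 - p) * μ2.toFun Q := by
  have f1 : (Function.support fun Q => p * μ1.toFun Q).Finite :=
    μ1.finite_support.subset (by intro a ha h; simp_all)
  have f2 : (Function.support fun Q => (1 - p) * μ2.toFun Q).Finite :=
    μ2.finite_support.subset (by intro a ha h; simp_all)
  refine ⟨⟨fun Q => p * μ1.toFun Q + (1 - p) * μ2.toFun Q, ?_, ?_, ?_⟩, fun _ => rfl⟩
  · intro a
    have := μ1.nonneg a
    have := μ2.nonneg a
    have : 0 ≤ 1 - p := by linarith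
    positivity
  · exact (f1.union f2).subset (Function.support_add _ _)
  · rw [finsum_add_distrib f1 f2, ← mul_finsum,
      ← mul_finsum, μ1.sum_one, μ2.sum_one]
    ring

theorem FinDist.mass_mix {α : Type} (μ1 μ2 μ : FinDist α) (p : ℝ) (φ : Set α)
    (hμ : ∀ Q, μ.toFun Q = p * μ1.toFun Q + (1 - p) * μ2.toFun Q) :
    μ.mass φ = p * μ1.mass φ + (1 - p) * μ2.mass φ := by
  unfold FinDist.mass
  have f1 : (φ ∩ Function.support fun Q => p * μ1.toFun Q).Finite :=
    μ1.finite_support.subset (by rintro a ⟨-, ha⟩ h; simp_all)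
  have f2 : (φ ∩ Function.support fun Q => (1 - p) * μ2.toFun Q).Finite :=
    μ2.finite_support.subset (by rintro a ⟨-, ha⟩ h; simp_all)
  simp only [hμ]
  rw [finsum_mem_add_distrib' f1 f2, mul_finsum_mem, mul_finsum_mem]

theorem FinDist.exists_step {α : Type} (μ ρ : FinDist α) (P : α) (q : ℝ) (h0 : 0 ≤ q)
    (h1 : q ≤ 1) : ∃ ν : FinDist α, ∀ Q, ν.toFun Q =
      μ.toFun Q + μ.toFun P * q * (ρ.toFun Q - (if Q = P then 1 else 0)) := by
  have hP := μ.nonneg P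
  have hs : (Function.support fun Q =>
      μ.toFun Q + μ.toFun P * q * (ρ.toFun Q - (if Q = P then 1 else 0))) ⊆
      ↑(μ.finite_support.toFinset ∪ ρ.finite_support.toFinset ∪ {P}) := by
    intro a ha
    by_contra hn
    simp at hn
    apply ha
    simp [hn]
  refine ⟨⟨_, ?_, (Finset.finite_toSet _).subset hs, ?_⟩, fun _ => rfl⟩
  · intro a
    have ha := μ.nonneg a
    have hr := ρ.nonneg a
    have hb : 0 ≤ μ.toFun P * q * ρ.toFun a := by positivity
    have hc : 0 ≤ μ.toFun P * (1 - q) := mul_nonneg hP (by linarith)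
    split_ifs with h
    · subst h; nlinarith
    · nlinarith
  · have e1 := μ.sum_one
    have e2 := ρ.sum_one
    rw [finsum_eq_sum_of_support_subset (s := μ.finite_support.toFinset ∪
      ρ.finite_support.toFinset ∪ {P}) _ (by intro a ha; simp at ha; simp [ha])] at e1
    rw [finsum_eq_sum_of_support_subset (s := μ.finite_support.toFinset ∪
      ρ.finite_support.toFinset ∪ {P}) _ (by intro a ha; simp at ha; simp [ha])] at e2
    rw [finsum_eq_sum_of_support_subset _ hs, Finset.sum_add_distrib, ← Finset.mul_sum,
      Finset.sum_sub_distrib, e1, e2, Finset.sum_ite_eq', if_pos (by simp)]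
    ring

theorem Internal.refl' {Proc Act : Type} (step : Proc → Act → FinDist Proc → Prop) (tau : Act)
    (μ : FinDist Proc) : Internal step tau μ μ := ⟨[], by simp, rfl⟩

theorem Internal.head' {Proc Act : Type} {step : Proc → Act → FinDist Proc → Prop} {tau : Act}
    {μ μ' ν : FinDist Proc} {q : ℝ} (h : DStep step μ tau q μ') (h' : Internal step tau μ' ν) :
    Internal step tau μ ν := by
  obtain ⟨π, h1, h2⟩ := h'
  refine ⟨(tau, q) :: π, ?_, μ', h, h2⟩
  intro s hs
  rcases List.mem_cons.1 hs with rfl | hs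
  · rfl
  · exact h1 s hs

theorem Internal.trans' {Proc Act : Type} {step : Proc → Act → FinDist Proc → Prop} {tau : Act}
    {μ μ' ν : FinDist Proc} (h : Internal step tau μ μ') (h' : Internal step tau μ' ν) :
    Internal step tau μ ν := by
  obtain ⟨π, h1, h2⟩ := h
  induction π generalizing μ with
  | nil => cases h2; exact h'
  | cons s π ih =>
    obtain ⟨μ'', hs, h2⟩ := h2
    rw [h1 s (by simp)] at hs
    exact Internal.head' hs (ih (fun t ht => h1 t (by simp [ht])) h2)

/-- A step with `μ(P)` possibly zero is an internal sequence. -/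
theorem Internal.of_step {Proc Act : Type} {step : Proc → Act → FinDist Proc → Prop} {tau : Act}
    {μ ν ρ : FinDist Proc} {P : Proc} {q : ℝ} (h0 : 0 ≤ q) (h1 : q ≤ 1) (hs : step P tau ρ)
    (h : ∀ Q, ν.toFun Q = μ.toFun Q + μ.toFun P * q * (ρ.toFun Q - (if Q = P then 1 else 0))) :
    Internal step tau μ ν := by
  by_cases hz : μ.toFun P * q = 0
  · have : ν = μ := FinDist.ext_fun (fun a => by rw [h, hz]; ring)
    rw [this]; exact Internal.refl' _ _ _
  · have hq : q ≠ 0 := fun e => hz (by simp [e])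
    have hP : μ.toFun P ≠ 0 := fun e => hz (by simp [e])
    exact Internal.head' ⟨lt_of_le_of_ne h0 hq.symm, h1, P, ρ,
      lt_of_le_of_ne (μ.nonneg P) hP.symm, hs, h⟩ (Internal.refl' _ _ _)

theorem Internal.mix_left {Proc Act : Type} {step : Proc → Act → FinDist Proc → Prop} {tau : Act}
    {μ1 μ2 μ ν1 : FinDist Proc} {p : ℝ} (hp0 : 0 ≤ p) (hp1 : p ≤ 1)
    (hμ : ∀ Q, μ.toFun Q = p * μ1.toFun Q + (1 - p) * μ2.toFun Q)
    (h : Internal step tau μ1 ν1) :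
    ∃ ν, Internal step tau μ ν ∧ ∀ Q, ν.toFun Q = p * ν1.toFun Q + (1 - p) * μ2.toFun Q := by
  obtain ⟨π, h1, h2⟩ := h
  induction π generalizing μ μ1 with
  | nil => cases h2; exact ⟨μ, Internal.refl' _ _ _, hμ⟩
  | cons s π ih =>
    obtain ⟨μ1', ⟨q0, q1, P, ρ, hP, hst, hstep⟩, h2⟩ := h2
    rw [h1 s (by simp)] at hst
    obtain ⟨μ', hμ'⟩ := FinDist.exists_mix μ1' μ2 p hp0 hp1
    obtain ⟨ν, hν, hν'⟩ := ih hμ' (fun t ht => h1 t (by simp [ht])) h2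
    refine ⟨ν, Internal.trans' ?_ hν, hν'⟩
    rcases hp0.eq_or_lt with rfl | hp
    · have : μ' = μ := FinDist.ext_fun (fun a => by rw [hμ, hμ']; ring)
      rw [this]; exact Internal.refl' _ _ _
    · have hb : 0 ≤ (1 - p) * μ2.toFun P := mul_nonneg (by linarith) (μ2.nonneg P)
      have ha : 0 < p * μ1.toFun P := mul_pos hp hP
      have hpos : 0 < μ.toFun P := by rw [hμ]; linarith
      refine Internal.of_step (P := P) (ρ := ρ) (q := p * μ1.toFun P * s.2 / μ.toFun P)
        (by positivity) ?_ hst ?_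
      · rw [div_le_one hpos, hμ]
        nlinarith
      · intro Q
        rw [mul_div_cancel₀ _ hpos.ne', hμ', hμ Q, hstep]
        ring

theorem Internal.split {Proc Act : Type} {step : Proc → Act → FinDist Proc → Prop} {tau : Act}
    {μ1 μ2 μ ν : FinDist Proc} {p : ℝ}
    (hμ : ∀ Q, μ.toFun Q = p * μ1.toFun Q + (1 - p) * μ2.toFun Q)
    (h : Internal step tau μ ν) :
    ∃ ν1 ν2, Internal step tau μ1 ν1 ∧ Internal step tau μ2 ν2 ∧
      ∀ Q, ν.toFun Q = p * ν1.toFun Q + (1 - p) * ν2.toFun Q := by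
  obtain ⟨π, h1, h2⟩ := h
  induction π generalizing μ μ1 μ2 with
  | nil => cases h2; exact ⟨μ1, μ2, Internal.refl' _ _ _, Internal.refl' _ _ _, hμ⟩
  | cons s π ih =>
    obtain ⟨μ', ⟨q0, q1, P, ρ, hP, hst, hstep⟩, h2⟩ := h2
    rw [h1 s (by simp)] at hst
    obtain ⟨μ1', e1⟩ := FinDist.exists_step μ1 ρ P s.2 q0.le q1
    obtain ⟨μ2', e2⟩ := FinDist.exists_step μ2 ρ P s.2 q0.le q1
    obtain ⟨ν1, ν2, i1, i2, hν⟩ := ih (μ := μ') (μ1 := μ1') (μ2 := μ2')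
      (fun Q => by rw [hstep, e1, e2, hμ, hμ P]; ring) (fun t ht => h1 t (by simp [ht])) h2
    exact ⟨ν1, ν2, (Internal.of_step q0.le q1 hst e1).trans' i1,
      (Internal.of_step q0.le q1 hst e2).trans' i2, hν⟩

/-- Testing outcomes are linear with respect to convex combinations:
`O^{p·μ1+(1−p)·μ2}_φ = p·O^{μ1}_φ + (1−p)·O^{μ2}_φ` (Minkowski sum). -/
theorem outcomes_convex_combination
    {Proc Act : Type} (step : Proc → Act → FinDist Proc → Prop) (tau : Act)
    (μ1 μ2 μ : FinDist Proc) (p : ℝ) (hp0 : 0 ≤ p) (hp1 : p ≤ 1)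
    (φ : Set Proc)
    (hμ : ∀ Q, μ.toFun Q = p * μ1.toFun Q + (1 - p) * μ2.toFun Q) :
    Outcomes step tau φ μ =
      {z | ∃ x ∈ Outcomes step tau φ μ1, ∃ y ∈ Outcomes step tau φ μ2,
            z = p * x + (1 - p) * y} := by
  ext z
  constructor
  · rintro ⟨ν, hν, rfl⟩
    obtain ⟨ν1, ν2, i1, i2, h⟩ := Internal.split hμ hν
    exact ⟨_, ⟨ν1, i1, rfl⟩, _, ⟨ν2, i2, rfl⟩, FinDist.mass_mix _ _ _ _ _ h⟩
  · rintro ⟨_, ⟨ν1, i1, rfl⟩, _, ⟨ν2, i2, rfl⟩, rfl⟩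
    obtain ⟨κ, hκ, eκ⟩ := Internal.mix_left hp0 hp1 hμ i1
    obtain ⟨ν, hν, eν⟩ := Internal.mix_left (μ1 := μ2) (μ2 := ν1) (μ := κ) (p := 1 - p)
      (by linarith) (by linarith) (fun Q => by rw [eκ]; ring) i2
    exact ⟨ν, hκ.trans' hν, (FinDist.mass_mix _ _ _ _ _ (fun Q => by rw [eν]; ring)).symm⟩
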